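/- Let 1 ≤ p1 < 2 < p2 < ∞. Then there exists a constant c > 0, depending only on p1 and p2, such that for all N ∈ ℕ and all n ∈ ℕ with n ≤ N/4 one has c^{-1} min{1, N^{1/p2} n^{-1/2}} ≤ d_n(id : ℓ_{p1}^N → ℓ_{p2}^N) ≤ c min{1, N^{1/p2} n^{-1/2}}. -/

import Mathlib

open scoped ENNReal Classical

/-- The `ℓ_p` norm on `ℂ^N`, for `p ∈ [1, ∞]` (`p = ∞` gives the sup-norm). -/
noncomputable def lpNorm (p : ℝ≥0∞) {N : ℕ} (x : Fin N → ℂ) : ℝ :=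
  if p = ∞ then ⨆ i, ‖x i‖ else (∑ i, ‖x i‖ ^ p.toReal) ^ (1 / p.toReal)

/-- The `n`-th Kolmogorov number of the identity map `id : ℓ_{p1}^N → ℓ_{p2}^N`:
the infimum, over all linear subspaces `L` of `ℓ_{p2}^N` of dimension `< n`, of
`sup_{‖x‖_{p1} ≤ 1} inf_{y ∈ L} ‖x - y‖_{p2}`. -/
noncomputable def kolmogorovLp (p1 p2 : ℝ≥0∞) (N n : ℕ) : ℝ :=
  sInf { r : ℝ | ∃ L : Submodule ℂ (Fin N → ℂ), Module.finrank ℂ L < n ∧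
    r = sSup { t : ℝ | ∃ x : Fin N → ℂ, lpNorm p1 x ≤ 1 ∧
      t = sInf { s : ℝ | ∃ y ∈ L, s = lpNorm p2 (x - y) } } }



/-- One step of symmetrization combined with contraction. -/
theorem sum_iSup_add_sub_abs_le {V ι : Type*} [Fintype V] [Nonempty V] [Finite ι] [Nonempty ι]
    (σ : V ≃ V) (h : V → ι → ℝ) (hσ : ∀ v i, h (σ v) i = -h v i) (c : ℝ)
    (hc : ∀ i, Fintype.card V * c ≤ ∑ v, |h v i|) (a : ι → ℝ) :
    ∑ v, ⨆ i, (a i + (c - |h v i|)) ≤ ∑ v, ⨆ i, (a i + 2 * h v i) := by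
  have bdd : ∀ f : ι → ℝ, BddAbove (Set.range f) := fun f => (Set.finite_range f).bddAbove
  set A : V → ℝ := fun v => ⨆ i, (a i + 2 * |h v i|) with hA
  set B : V → ℝ := fun v => ⨆ i, (a i - 2 * |h v i|) with hB
  set C : V → ℝ := fun v => ⨆ i, (a i + 2 * h v i) with hC
  have hcard : (0 : ℝ) < Fintype.card V := by exact_mod_cast Fintype.card_pos
  have hle : ∀ v, ⨆ i, (a i + (c - |h v i|)) ≤ ((∑ v', A v') / Fintype.card V + B v) / 2 := by
    intro v
    refine ciSup_le fun i => ?_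
    have hAi : ∑ v', (a i + 2 * |h v' i|) ≤ ∑ v', A v' :=
      Finset.sum_le_sum fun v' _ => le_ciSup (bdd fun i => a i + 2 * |h v' i|) i
    have hBi : a i - 2 * |h v i| ≤ B v := le_ciSup (bdd fun i => a i - 2 * |h v i|) i
    rw [Finset.sum_add_distrib, ← Finset.mul_sum, Finset.sum_const, Finset.card_univ,
      nsmul_eq_mul] at hAi
    have : a i + 2 * c ≤ (∑ v', A v') / Fintype.card V := by
      rw [le_div_iff₀ hcard]
      linarith [hc i]
    linarith
  have hAB : ∀ v, A v + B v ≤ C v + C (σ v) := by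
    intro v
    have key : ∀ i j, (a i + 2 * |h v i|) + (a j - 2 * |h v j|) ≤ C v + C (σ v) := by
      intro i j
      have h1 : ∀ i, a i + 2 * h v i ≤ C v := fun i => le_ciSup (bdd fun i => a i + 2 * h v i) i
      have h2 : ∀ i, a i - 2 * h v i ≤ C (σ v) := fun i => by
        have := le_ciSup (bdd fun i => a i + 2 * h (σ v) i) i
        simp only [hσ] at this
        simp only [hC, hσ]
        linarith
      rcases abs_cases (h v i) with ⟨e, _⟩ | ⟨e, _⟩ <;> rw [e]
      · linarith [h1 i, h2 j, le_abs_self (h v j)]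
      · linarith [h1 j, h2 i, neg_abs_le (h v j)]
    have hAle : A v ≤ C v + C (σ v) - B v := by
      refine ciSup_le fun i => ?_
      have : B v ≤ C v + C (σ v) - (a i + 2 * |h v i|) :=
        ciSup_le fun j => by linarith [key i j]
      linarith
    linarith
  have hsum := Finset.sum_le_sum fun v (_ : v ∈ Finset.univ) => hAB v
  rw [Finset.sum_add_distrib, Finset.sum_add_distrib, Equiv.sum_comp σ C] at hsum
  calc _ ≤ ∑ v, ((∑ v', A v') / Fintype.card V + B v) / 2 :=
        Finset.sum_le_sum fun v _ => hle v
    _ = (∑ v, A v + ∑ v, B v) / 2 := by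
        rw [← Finset.sum_div, Finset.sum_add_distrib, Finset.sum_const, Finset.card_univ,
          nsmul_eq_mul, mul_div_cancel₀ _ hcard.ne']
    _ ≤ _ := by linarith

theorem sum_pi_fin_succ {V : Type*} [Fintype V] {m : ℕ} (F : (Fin (m + 1) → V) → ℝ) :
    ∑ X, F X = ∑ v, ∑ Y : Fin m → V, F (Fin.cons v Y) := by
  rw [← Fintype.sum_prod_type']
  exact (Equiv.sum_comp (Fin.consEquiv fun _ => V) F).symm

theorem sum_iSup_add_sum_sub_abs_le {V ι : Type*} [Fintype V] [Nonempty V] [Finite ι] [Nonempty ι]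
    (σ : V ≃ V) (h : V → ι → ℝ) (hσ : ∀ v i, h (σ v) i = -h v i) (c : ℝ)
    (hc : ∀ i, Fintype.card V * c ≤ ∑ v, |h v i|) (m : ℕ) (a : ι → ℝ) :
    ∑ X : Fin m → V, ⨆ i, (a i + ∑ k, (c - |h (X k) i|)) ≤
      ∑ X : Fin m → V, ⨆ i, (a i + ∑ k, 2 * h (X k) i) := by
  induction m generalizing a with
  | zero => simp
  | succ m ih =>
    rw [sum_pi_fin_succ, sum_pi_fin_succ]
    simp only [Fin.sum_univ_succ, Fin.cons_zero, Fin.cons_succ, ← add_assoc]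
    calc _ ≤ ∑ v, ∑ Y : Fin m → V, ⨆ i, (a i + (c - |h v i|) + ∑ k, 2 * h (Y k) i) :=
          Finset.sum_le_sum fun v _ => ih _
      _ = ∑ Y : Fin m → V, ∑ v, ⨆ i, ((a i + ∑ k, 2 * h (Y k) i) + (c - |h v i|)) := by
          rw [Finset.sum_comm]
          simp only [add_right_comm]
      _ ≤ ∑ Y : Fin m → V, ∑ v, ⨆ i, ((a i + ∑ k, 2 * h (Y k) i) + 2 * h v i) :=
          Finset.sum_le_sum fun Y _ => sum_iSup_add_sub_abs_le σ h hσ c hc _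
      _ = _ := by
          rw [Finset.sum_comm]
          simp only [add_right_comm]

/-- The sum `∑ j, v j * u j` with signs `v`. -/
noncomputable def signSum {N : ℕ} (v : Fin N → ℤˣ) (u : Fin N → ℝ) : ℝ :=
  ∑ j, ((v j : ℤ) : ℝ) * u j

theorem signSum_cons {N : ℕ} (e : ℤˣ) (v : Fin N → ℤˣ) (u : Fin (N + 1) → ℝ) :
    signSum (Fin.cons e v : Fin (N + 1) → ℤˣ) u =
      ((e : ℤ) : ℝ) * u 0 + signSum v (fun j => u j.succ) := by
  simp [signSum, Fin.sum_univ_succ]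

theorem sum_signSum_sq {N : ℕ} (u : Fin N → ℝ) :
    ∑ v, signSum v u ^ 2 = 2 ^ N * ∑ j, u j ^ 2 := by
  induction N with
  | zero => simp [signSum]
  | succ N ih =>
    rw [sum_pi_fin_succ, Finset.sum_comm, Fin.sum_univ_succ]
    have h : ∀ v : Fin N → ℤˣ, ∑ e : ℤˣ, signSum (Fin.cons e v : Fin (N + 1) → ℤˣ) u ^ 2 =
        2 * signSum v (fun j => u j.succ) ^ 2 + 2 * u 0 ^ 2 := by
      intro v
      rw [UnitsInt.univ, Finset.sum_pair (by decide)]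
      simp only [signSum_cons]
      push_cast
      ring
    simp only [h, Finset.sum_add_distrib, ← Finset.mul_sum, ih]
    simp
    ring

theorem sum_signSum_pow_four_le {N : ℕ} (u : Fin N → ℝ) :
    ∑ v, signSum v u ^ 4 ≤ 3 * 2 ^ N * (∑ j, u j ^ 2) ^ 2 := by
  induction N with
  | zero => simp [signSum]
  | succ N ih =>
    rw [sum_pi_fin_succ, Finset.sum_comm, Fin.sum_univ_succ]
    have h : ∀ v : Fin N → ℤˣ, ∑ e : ℤˣ, signSum (Fin.cons e v : Fin (N + 1) → ℤˣ) u ^ 4 =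
        2 * signSum v (fun j => u j.succ) ^ 4 +
          (12 * u 0 ^ 2) * signSum v (fun j => u j.succ) ^ 2 + 2 * u 0 ^ 4 := by
      intro v
      rw [UnitsInt.univ, Finset.sum_pair (by decide)]
      simp only [signSum_cons]
      push_cast
      ring
    have ih' := ih fun j => u j.succ
    simp only [h, Finset.sum_add_distrib, ← Finset.mul_sum, sum_signSum_sq]
    simp only [Finset.sum_const, Finset.card_univ, Fintype.card_pi, Fintype.card_units_int,
      Finset.prod_const, Fintype.card_fin, nsmul_eq_mul]
    push_cast
    have : 0 ≤ (2 : ℝ) ^ N * u 0 ^ 4 := by positivity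
    rw [pow_succ 2 N]
    linarith

/-- Khinchine's inequality in `L₁`. -/
theorem card_mul_le_sum_abs_signSum {N : ℕ} (u : Fin N → ℝ) (hu : ∑ j, u j ^ 2 = 1) :
    (Fintype.card (Fin N → ℤˣ) : ℝ) * (9 / 16) ≤ ∑ v, |signSum v u| := by
  have hpt : ∀ s : ℝ, (3 / 4) * s ^ 2 - (1 / 16) * s ^ 4 ≤ |s| := by
    intro s
    have h0 := abs_nonneg s
    have h2 : s ^ 2 = |s| ^ 2 := (sq_abs s).symm
    have h4 : s ^ 4 = |s| ^ 4 := by rw [show 4 = 2 * 2 from rfl, pow_mul, pow_mul, sq_abs]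
    rw [h2, h4]
    nlinarith [mul_nonneg h0 (mul_nonneg (sq_nonneg (|s| - 2)) (by linarith : 0 ≤ |s| + 4))]
  have h := Finset.sum_le_sum fun v (_ : v ∈ Finset.univ) => hpt (signSum (N := N) v u)
  rw [Finset.sum_sub_distrib, ← Finset.mul_sum, ← Finset.mul_sum, sum_signSum_sq, hu] at h
  have h4 := sum_signSum_pow_four_le u
  rw [hu] at h4
  simp only [Fintype.card_pi, Fintype.card_units_int, Finset.prod_const, Finset.card_univ,
    Fintype.card_fin]
  push_cast
  linarith

theorem sum_exp_sign {N : ℕ} (j : Fin N) (t : ℝ) :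
    ∑ v : Fin N → ℤˣ, Real.exp (t * ((v j : ℤ) : ℝ)) =
      Fintype.card (Fin N → ℤˣ) * Real.cosh t := by
  have hneg : ∑ v : Fin N → ℤˣ, Real.exp (t * ((v j : ℤ) : ℝ)) =
      ∑ v : Fin N → ℤˣ, Real.exp (-(t * ((v j : ℤ) : ℝ))) := by
    rw [← Equiv.sum_comp (Equiv.neg (Fin N → ℤˣ))]
    simp
  have hcosh : ∀ v : Fin N → ℤˣ, Real.exp (t * ((v j : ℤ) : ℝ)) +
      Real.exp (-(t * ((v j : ℤ) : ℝ))) = 2 * Real.cosh t := by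
    intro v
    rw [Real.cosh_eq]
    rcases Int.units_eq_one_or (v j) with h | h <;> simp [h] <;> ring
  have : 2 * ∑ v : Fin N → ℤˣ, Real.exp (t * ((v j : ℤ) : ℝ)) =
      ∑ v : Fin N → ℤˣ, 2 * Real.cosh t := by
    rw [two_mul]
    nth_rw 2 [hneg]
    rw [← Finset.sum_add_distrib]
    exact Finset.sum_congr rfl fun v _ => hcosh v
  rw [Finset.sum_const, Finset.card_univ, nsmul_eq_mul] at this
  linarith

theorem sum_exp_sum_sign_le {N m : ℕ} (j : Fin N) (t : ℝ) :
    ∑ X : Fin m → Fin N → ℤˣ, Real.exp (t * ∑ k, ((X k j : ℤ) : ℝ)) ≤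
      Fintype.card (Fin m → Fin N → ℤˣ) * Real.exp (m * (t ^ 2 / 2)) := by
  simp only [Finset.mul_sum, Real.exp_sum]
  rw [← Fintype.sum_pow (fun v : Fin N → ℤˣ => Real.exp (t * ((v j : ℤ) : ℝ))), sum_exp_sign,
    mul_pow, Real.exp_nat_mul]
  simp only [Fintype.card_fun, Fintype.card_fin]
  push_cast
  gcongr
  exact Real.cosh_le_exp_half_sq t

theorem rpow_abs_le_exp_add_exp {q : ℝ} (hq : 0 ≤ q) (s : ℝ) :
    |s| ^ q ≤ (1 + (⌈q⌉₊).factorial) * (Real.exp s + Real.exp (-s)) := by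
  have h0 := abs_nonneg s
  have h1 : |s| ^ q ≤ 1 + |s| ^ ⌈q⌉₊ := by
    rcases le_total |s| 1 with h | h
    · have := Real.rpow_le_one h0 h hq
      have : 0 ≤ |s| ^ ⌈q⌉₊ := by positivity
      linarith
    · rw [← Real.rpow_natCast]
      have := Real.rpow_le_rpow_of_exponent_le h (Nat.le_ceil q)
      linarith
  have h2 : |s| ^ ⌈q⌉₊ ≤ (⌈q⌉₊).factorial * Real.exp |s| := by
    have := Real.pow_div_factorial_le_exp |s| h0 ⌈q⌉₊
    rwa [div_le_iff₀ (by positivity), mul_comm] at this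
  have h3 : Real.exp |s| ≤ Real.exp s + Real.exp (-s) := by
    rcases abs_cases s with ⟨e, _⟩ | ⟨e, _⟩ <;> rw [e] <;>
      linarith [Real.exp_pos s, Real.exp_pos (-s)]
  have h4 := Real.one_le_exp h0
  calc |s| ^ q ≤ (1 + (⌈q⌉₊).factorial) * Real.exp |s| := by linarith
    _ ≤ _ := by gcongr

/-- The constant in the `L_q` bound for sums of random signs. -/
noncomputable def momentConst (q : ℝ) : ℝ :=
  (1 + (⌈q⌉₊).factorial) * (2 * Real.exp (1 / 2))

theorem momentConst_pos (q : ℝ) : 0 < momentConst q := by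
  unfold momentConst
  positivity

theorem sum_rpow_abs_sum_sign_le {N m : ℕ} (hm : 0 < m) {q : ℝ} (hq : 0 ≤ q) (j : Fin N) :
    ∑ X : Fin m → Fin N → ℤˣ, |∑ k, ((X k j : ℤ) : ℝ)| ^ q ≤
      Fintype.card (Fin m → Fin N → ℤˣ) * (momentConst q * √m ^ q) := by
  have hm' : (0 : ℝ) < m := by exact_mod_cast hm
  have hs : 0 < √(m : ℝ) := Real.sqrt_pos.2 hm'
  set K : ℝ := ((Fintype.card (Fin m → Fin N → ℤˣ) : ℕ) : ℝ)
  have hexp : ∀ t : ℝ, t ^ 2 = 1 / m → ∑ X : Fin m → Fin N → ℤˣ,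
      Real.exp (t * ∑ k, ((X k j : ℤ) : ℝ)) ≤ K * Real.exp (1 / 2) := by
    intro t ht
    refine (sum_exp_sum_sign_le j t).trans_eq ?_
    rw [ht]
    congr 2
    field_simp
  have hpt : ∀ X : Fin m → Fin N → ℤˣ, |∑ k, ((X k j : ℤ) : ℝ)| ^ q ≤
      √m ^ q * ((1 + (⌈q⌉₊).factorial) * (Real.exp ((√m)⁻¹ * ∑ k, ((X k j : ℤ) : ℝ)) +
        Real.exp (-(√m)⁻¹ * ∑ k, ((X k j : ℤ) : ℝ)))) := by
    intro X
    have := rpow_abs_le_exp_add_exp hq ((√m)⁻¹ * ∑ k, ((X k j : ℤ) : ℝ))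
    rw [abs_mul, Real.mul_rpow (abs_nonneg _) (abs_nonneg _), abs_of_pos (inv_pos.2 hs),
      Real.inv_rpow hs.le, inv_mul_le_iff₀ (by positivity), ← neg_mul] at this
    exact this
  have h1 := hexp (√m)⁻¹ (by rw [inv_pow, Real.sq_sqrt hm'.le, one_div])
  have h2 := hexp (-(√m)⁻¹) (by rw [neg_sq, inv_pow, Real.sq_sqrt hm'.le, one_div])
  calc _ ≤ _ := Finset.sum_le_sum fun X _ => hpt X
    _ ≤ √m ^ q * ((1 + (⌈q⌉₊).factorial) * (K * Real.exp (1 / 2) + K * Real.exp (1 / 2))) := by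
        rw [← Finset.mul_sum, ← Finset.mul_sum, Finset.sum_add_distrib]
        gcongr
    _ = _ := by unfold momentConst; ring

theorem sum_lq_norm_sum_sign_le {N m : ℕ} (hm : 0 < m) {q : ℝ} (hq : 1 ≤ q) :
    ∑ X : Fin m → Fin N → ℤˣ, (∑ j, |∑ k, ((X k j : ℤ) : ℝ)| ^ q) ^ (1 / q) ≤
      Fintype.card (Fin m → Fin N → ℤˣ) *
        (momentConst q ^ (1 / q) * (N : ℝ) ^ (1 / q) * √m) := by
  have hq0 : 0 < q := by linarith
  have hM := (momentConst_pos q).le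
  set K : ℝ := ((Fintype.card (Fin m → Fin N → ℤˣ) : ℕ) : ℝ)
  have hK : 0 < K := Nat.cast_pos.2 Fintype.card_pos
  set f : (Fin m → Fin N → ℤˣ) → ℝ :=
    fun X => (∑ j, |∑ k, ((X k j : ℤ) : ℝ)| ^ q) ^ (1 / q) with hf
  have hf0 : ∀ X, 0 ≤ f X := fun X => by simp only [hf]; positivity
  have hfq : ∀ X, f X ^ q = ∑ j, |∑ k, ((X k j : ℤ) : ℝ)| ^ q := fun X => by
    simp only [hf]
    rw [← Real.rpow_mul (by positivity), one_div_mul_cancel hq0.ne', Real.rpow_one]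
  have hsum : ∑ X, f X ^ q ≤ K * (N * (momentConst q * √m ^ q)) := by
    simp only [hfq]
    rw [Finset.sum_comm]
    calc _ ≤ ∑ j : Fin N, K * (momentConst q * √m ^ q) :=
          Finset.sum_le_sum fun j _ => sum_rpow_abs_sum_sign_le hm hq0.le j
      _ = _ := by
          rw [Finset.sum_const, Finset.card_univ, Fintype.card_fin, nsmul_eq_mul]
          ring
  have hJ := Real.rpow_sum_le_const_mul_sum_rpow Finset.univ f hq
  simp only [abs_of_nonneg (hf0 _), Finset.card_univ] at hJ
  rw [← Real.rpow_le_rpow_iff (Finset.sum_nonneg fun X _ => hf0 X) (by positivity) hq0]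
  calc _ ≤ K ^ (q - 1) * ∑ X, f X ^ q := hJ
    _ ≤ K ^ (q - 1) * (K * (N * (momentConst q * √m ^ q))) := by gcongr
    _ = (K ^ (q - 1) * K) * (momentConst q * N * √m ^ q) := by ring
    _ = _ := by
        rw [Real.rpow_sub_one hK.ne', div_mul_cancel₀ _ hK.ne', Real.mul_rpow hK.le (by positivity),
          Real.mul_rpow (by positivity) (by positivity),
          Real.mul_rpow (by positivity) (by positivity), ← Real.rpow_mul hM,
          ← Real.rpow_mul (by positivity), one_div_mul_cancel hq0.ne', Real.rpow_one, Real.rpow_one]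

/-- The kernel of a suitable sign matrix meets the dual ball of `ℓ_q^N` in a set of small Euclidean
radius. -/
theorem exists_signs_sqrt_sum_sq_le {N m : ℕ} (hN : 0 < N) (hm : 0 < m) {q : ℝ} (hq : 1 ≤ q) :
    ∃ X : Fin m → Fin N → ℤˣ, ∀ u : Fin N → ℝ, (∀ k, signSum (X k) u = 0) →
      (∀ w : Fin N → ℝ, ∑ j, w j * u j ≤ (∑ j, |w j| ^ q) ^ (1 / q)) →
      √(∑ j, u j ^ 2) ≤ 4 * (momentConst q ^ (1 / q) * (N : ℝ) ^ (1 / q)) / √m := by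
  have hm' : (0 : ℝ) < m := by exact_mod_cast hm
  have hN' : (0 : ℝ) < N := by exact_mod_cast hN
  have hs : 0 < √(m : ℝ) := Real.sqrt_pos.2 hm'
  have hM := momentConst_pos q
  set D : ℝ := momentConst q ^ (1 / q) * (N : ℝ) ^ (1 / q) with hD
  have hD0 : 0 < D := by positivity
  by_contra! hcon
  choose u hker hdual hlarge using hcon
  set ρ : (Fin m → Fin N → ℤˣ) → ℝ := fun X => √(∑ j, u X j ^ 2) with hρ
  have hρ0 : ∀ X, 0 < ρ X := fun X => lt_trans (by positivity) (hlarge X)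
  set t : (Fin m → Fin N → ℤˣ) → Fin N → ℝ := fun X j => (ρ X)⁻¹ * u X j with ht
  have hsS : ∀ v X, signSum v (t X) = (ρ X)⁻¹ * signSum v (u X) := by
    intro v X
    simp only [signSum, ht, Finset.mul_sum]
    exact Finset.sum_congr rfl fun j _ => by ring
  have ht1 : ∀ X, ∑ j, t X j ^ 2 = 1 := by
    intro X
    simp only [ht, mul_pow, ← Finset.mul_sum]
    have : ρ X ^ 2 = ∑ j, u X j ^ 2 := Real.sq_sqrt (by positivity)
    rw [← this, ← mul_pow, inv_mul_cancel₀ (hρ0 X).ne', one_pow]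
  have key := sum_iSup_add_sum_sub_abs_le (Equiv.neg (Fin N → ℤˣ)) (fun v X => signSum v (t X))
    (fun v X => by simp [signSum]) (9 / 16)
    (fun X => card_mul_le_sum_abs_signSum (t X) (ht1 X)) m (fun _ => 0)
  set K : ℝ := ((Fintype.card (Fin m → Fin N → ℤˣ) : ℕ) : ℝ) with hKdef
  have hK : 0 < K := Nat.cast_pos.2 Fintype.card_pos
  have hlow : K * (m * (9 / 16)) ≤ ∑ X : Fin m → Fin N → ℤˣ,
      ⨆ Y, ((0 : ℝ) + ∑ k, (9 / 16 - |signSum (X k) (t Y)|)) := by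
    rw [hKdef, ← nsmul_eq_mul, ← Finset.card_univ]
    refine Finset.card_nsmul_le_sum _ _ _ fun X _ => ?_
    refine le_trans ?_ (le_ciSup (f := fun Y => (0 : ℝ) + ∑ k, (9 / 16 - |signSum (X k) (t Y)|))
      (Set.finite_range _).bddAbove X)
    simp [hsS, hker]
  have hup : ∑ X : Fin m → Fin N → ℤˣ, ⨆ Y, ((0 : ℝ) + ∑ k, 2 * signSum (X k) (t Y)) ≤
      ∑ X : Fin m → Fin N → ℤˣ,
        (√m / (2 * D)) * (∑ j, |∑ k, ((X k j : ℤ) : ℝ)| ^ q) ^ (1 / q) := by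
    refine Finset.sum_le_sum fun X _ => ciSup_le fun Y => ?_
    have h1 : (0 : ℝ) + ∑ k, 2 * signSum (X k) (t Y) =
        2 * (ρ Y)⁻¹ * ∑ j, (∑ k, ((X k j : ℤ) : ℝ)) * u Y j := by
      simp only [hsS]
      simp only [signSum, Finset.mul_sum, Finset.sum_mul, zero_add]
      rw [Finset.sum_comm]
      exact Finset.sum_congr rfl fun j _ => Finset.sum_congr rfl fun k _ => by ring
    rw [h1]
    have h2 : 2 * (ρ Y)⁻¹ ≤ √m / (2 * D) := by
      have := inv_anti₀ (by positivity) (hlarge Y).le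
      rw [inv_div] at this
      calc _ ≤ 2 * (√m / (4 * D)) := by gcongr
        _ = _ := by field_simp; norm_num
    have := hρ0 Y
    refine (mul_le_mul_of_nonneg_left (hdual Y _) (by positivity)).trans ?_
    exact mul_le_mul_of_nonneg_right h2 (by positivity)
  have hmom := sum_lq_norm_sum_sign_le (N := N) hm hq
  rw [← Finset.mul_sum] at hup
  have hfin : K * (m * (9 / 16)) ≤ (√m / (2 * D)) * (K * (D * √m)) :=
    (hlow.trans key).trans (hup.trans (by gcongr))
  have : (√m / (2 * D)) * (K * (D * √m)) = K * (m / 2) := by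
    field_simp
    rw [Real.sq_sqrt hm'.le]
  rw [this] at hfin
  have := le_of_mul_le_mul_left hfin hK
  linarith

theorem lpNorm_eq_norm_toLp {p : ℝ≥0∞} (hp0 : p ≠ 0) (hp : p ≠ ∞) {N : ℕ} (x : Fin N → ℂ) :
    lpNorm p x = ‖(WithLp.toLp p x : PiLp p fun _ : Fin N => ℂ)‖ := by
  rw [lpNorm, if_neg hp, PiLp.norm_eq_sum (ENNReal.toReal_pos hp0 hp)]

theorem lpNorm_nonneg (p : ℝ≥0∞) {N : ℕ} (x : Fin N → ℂ) : 0 ≤ lpNorm p x := by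
  unfold lpNorm
  split_ifs
  · exact Real.iSup_nonneg fun i => norm_nonneg _
  · positivity

theorem bddBelow_lpNorm_sub (p : ℝ≥0∞) {N : ℕ} (L : Submodule ℂ (Fin N → ℂ)) (x : Fin N → ℂ) :
    BddBelow {s : ℝ | ∃ y ∈ L, s = lpNorm p (x - y)} :=
  ⟨0, by rintro _ ⟨y, _, rfl⟩; exact lpNorm_nonneg p _⟩

/-- Distances in `ℓ_p^N` to a subspace are bounded through its annihilator. -/
theorem sInf_lpNorm_sub_le_of_dual {p : ℝ≥0∞} (hp1 : 1 ≤ p) (hp : p ≠ ∞) {N : ℕ}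
    (L : Submodule ℂ (Fin N → ℂ)) (x : Fin N → ℂ) {B : ℝ}
    (hB : ∀ a : Fin N → ℂ, (∀ y ∈ L, ∑ j, y j * a j = 0) →
      (∀ w : Fin N → ℂ, ‖∑ j, w j * a j‖ ≤ lpNorm p w) → ‖∑ j, x j * a j‖ ≤ B) :
    sInf {s : ℝ | ∃ y ∈ L, s = lpNorm p (x - y)} ≤ B := by
  have : Fact (1 ≤ p) := ⟨hp1⟩
  have hp0 : p ≠ 0 := (zero_lt_one.trans_le hp1).ne'
  let e := (WithLp.linearEquiv p ℂ (Fin N → ℂ)).symm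
  let S : Submodule ℂ (PiLp p fun _ : Fin N => ℂ) := L.map e.toLinearMap
  obtain ⟨f, hf1, hfx⟩ := exists_dual_vector'' ℂ (S.mkQ (e x))
  let g : (Fin N → ℂ) →ₗ[ℂ] ℂ := f.toLinearMap ∘ₗ S.mkQ ∘ₗ e.toLinearMap
  have hg : ∀ w, g w = f (S.mkQ (e w)) := fun w => rfl
  have hgsum : ∀ w, ∑ j, w j * g (Pi.single j 1) = g w := by
    intro w
    conv_rhs => rw [pi_eq_sum_univ' w, map_sum]
    refine Finset.sum_congr rfl fun j _ => ?_
    rw [map_smul, smul_eq_mul]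
  have hgle : ∀ w, ‖g w‖ ≤ lpNorm p w := by
    intro w
    rw [hg, lpNorm_eq_norm_toLp hp0 hp]
    calc ‖f (S.mkQ (e w))‖ ≤ 1 * ‖S.mkQ (e w)‖ := f.le_of_opNorm_le hf1 _
      _ ≤ ‖e w‖ := by rw [one_mul]; exact Submodule.Quotient.norm_mk_le S (e w)
  have hnorm : ‖S.mkQ (e x)‖ ≤ B := by
    have h := hB (fun j => g (Pi.single j 1)) (fun y hy => ?_) (fun w => ?_)
    · rw [hgsum, hg, hfx] at h
      simpa using h
    · have hzero : S.mkQ (e y) = 0 :=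
        (Submodule.Quotient.mk_eq_zero S).2 (Submodule.mem_map_of_mem hy)
      rw [hgsum, hg, hzero, map_zero]
    · rw [hgsum]
      exact hgle w
  refine le_of_forall_pos_le_add fun ε hε => ?_
  obtain ⟨z, hz, hzlt⟩ := Submodule.Quotient.norm_mk_lt (S.mkQ (e x)) hε
  have hmem : e x - z ∈ S := by
    rw [← Submodule.Quotient.mk_eq_zero, Submodule.Quotient.mk_sub, hz]
    exact sub_self _
  obtain ⟨y, hy, hyz⟩ := hmem
  refine (csInf_le (bddBelow_lpNorm_sub p L x) ⟨y, hy, rfl⟩).trans ?_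
  have : e (x - y) = z := by
    rw [map_sub]
    have : e y = e x - z := hyz
    rw [this, sub_sub_cancel]
  rw [lpNorm_eq_norm_toLp hp0 hp]
  change ‖e (x - y)‖ ≤ _
  rw [this]
  linarith

theorem exists_submodule_sInf_lpNorm_sub_le {p : ℝ≥0∞} (hp1 : 1 ≤ p) (hp : p ≠ ∞) {N m : ℕ}
    (hN : 0 < N) (hm : 0 < m) :
    ∃ L : Submodule ℂ (Fin N → ℂ), Module.finrank ℂ L ≤ m ∧
      ∀ x : Fin N → ℂ, ∑ j, ‖x j‖ ^ 2 ≤ 1 →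
        sInf {s : ℝ | ∃ y ∈ L, s = lpNorm p (x - y)} ≤
          8 * (momentConst p.toReal ^ (1 / p.toReal) * (N : ℝ) ^ (1 / p.toReal)) / √m := by
  have hq : 1 ≤ p.toReal := by
    simpa using ENNReal.toReal_mono hp hp1
  obtain ⟨X, hX⟩ := exists_signs_sqrt_sum_sq_le hN hm hq
  set D : ℝ := momentConst p.toReal ^ (1 / p.toReal) * (N : ℝ) ^ (1 / p.toReal)
  let r : Fin m → Fin N → ℂ := fun k j => ((X k j : ℤ) : ℂ)
  refine ⟨Submodule.span ℂ (Set.range r), ?_, fun x hx => ?_⟩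
  · simpa [Set.finrank] using finrank_range_le_card (R := ℂ) r
  refine sInf_lpNorm_sub_le_of_dual hp1 hp _ x fun a hann hdual => ?_
  have hker : ∀ k, ∑ j, r k j * a j = 0 := fun k =>
    hann _ (Submodule.subset_span (Set.mem_range_self k))
  have hw : ∀ w : Fin N → ℝ, ‖∑ j, (w j : ℂ) * a j‖ ≤
      (∑ j, |w j| ^ p.toReal) ^ (1 / p.toReal) := by
    intro w
    simpa [lpNorm, hp] using hdual fun j => (w j : ℂ)
  have hre := hX (fun j => (a j).re)
    (fun k => by simpa [r, signSum] using congrArg Complex.re (hker k))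
    (fun w => by simpa using (Complex.re_le_norm _).trans (hw w))
  have him := hX (fun j => (a j).im)
    (fun k => by simpa [r, signSum] using congrArg Complex.im (hker k))
    (fun w => by simpa using (Complex.im_le_norm _).trans (hw w))
  have ha : √(∑ j, ‖a j‖ ^ 2) ≤ 8 * D / √m := by
    have hsplit : ∑ j, ‖a j‖ ^ 2 = ∑ j, (a j).re ^ 2 + ∑ j, (a j).im ^ 2 := by
      rw [← Finset.sum_add_distrib]
      refine Finset.sum_congr rfl fun j _ => ?_
      rw [Complex.sq_norm, Complex.normSq_apply]
      ring
    rw [hsplit]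
    have hb : 0 ≤ 4 * D / √m := (Real.sqrt_nonneg _).trans hre
    rw [Real.sqrt_le_left hb] at hre him
    rw [show 8 * D / √m = 2 * (4 * D / √m) by ring, Real.sqrt_le_left (by positivity), mul_pow]
    linarith [sq_nonneg (4 * D / √m)]
  calc ‖∑ j, x j * a j‖ ≤ ∑ j, ‖x j‖ * ‖a j‖ :=
        (norm_sum_le _ _).trans_eq (by simp only [norm_mul])
    _ ≤ √(∑ j, ‖x j‖ ^ 2) * √(∑ j, ‖a j‖ ^ 2) := Real.sum_mul_le_sqrt_mul_sqrt _ _ _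
    _ ≤ 1 * √(∑ j, ‖a j‖ ^ 2) := by
        gcongr
        exact Real.sqrt_le_one.2 hx
    _ ≤ _ := by rwa [one_mul]

theorem norm_sum_diag_le {N : ℕ} (L : Submodule ℂ (EuclideanSpace ℂ (Fin N)))
    (y : Fin N → EuclideanSpace ℂ (Fin N)) (hy : ∀ j, y j ∈ L) :
    ‖∑ j, y j j‖ ≤ √(Module.finrank ℂ L) * √(∑ j, ‖y j‖ ^ 2) := by
  let b := stdOrthonormalBasis ℂ L
  let c : Fin N → ℝ := fun j => √(∑ k, ‖(b k : EuclideanSpace ℂ (Fin N)) j‖ ^ 2)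
  have hentry : ∀ j, ‖y j j‖ ≤ c j * ‖y j‖ := by
    intro j
    have hrep := congrArg (fun z : L => (z : EuclideanSpace ℂ (Fin N)) j)
      (b.sum_repr ⟨y j, hy j⟩)
    simp only [AddSubmonoidClass.coe_finsetSum, Submodule.coe_smul, WithLp.ofLp_sum,
      Finset.sum_apply, PiLp.smul_apply, smul_eq_mul] at hrep
    rw [← hrep]
    have hn : ‖y j‖ = √(∑ k, ‖b.repr ⟨y j, hy j⟩ k‖ ^ 2) := by
      rw [← EuclideanSpace.norm_eq, b.repr.norm_map]
      rfl
    rw [hn, mul_comm]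
    refine (norm_sum_le _ _).trans ?_
    simp only [norm_mul]
    exact Real.sum_mul_le_sqrt_mul_sqrt _ _ _
  have hc : ∑ j, c j ^ 2 = Module.finrank ℂ L := by
    have hsq : ∀ j, c j ^ 2 = ∑ k, ‖(b k : EuclideanSpace ℂ (Fin N)) j‖ ^ 2 :=
      fun j => Real.sq_sqrt (by positivity)
    simp only [hsq]
    rw [Finset.sum_comm]
    have hone : ∀ k, ∑ j, ‖(b k : EuclideanSpace ℂ (Fin N)) j‖ ^ 2 = 1 := by
      intro k
      rw [← EuclideanSpace.norm_sq_eq, ← Submodule.coe_norm, b.norm_eq_one, one_pow]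
    simp [hone]
  calc _ ≤ ∑ j, c j * ‖y j‖ := (norm_sum_le _ _).trans (Finset.sum_le_sum fun j _ => hentry j)
    _ ≤ √(∑ j, c j ^ 2) * √(∑ j, ‖y j‖ ^ 2) := Real.sum_mul_le_sqrt_mul_sqrt _ _ _
    _ = _ := by rw [hc]

theorem norm_euclidean_le_mul_lpNorm {p : ℝ≥0∞} (hp2 : 2 ≤ p) (hp : p ≠ ∞) {N : ℕ} (hN : 0 < N)
    (z : Fin N → ℂ) :
    ‖WithLp.toLp 2 z‖ ≤ √N / (N : ℝ) ^ (1 / p.toReal) * lpNorm p z := by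
  have hq : 2 ≤ p.toReal := by simpa using ENNReal.toReal_mono hp hp2
  have hN' : (0 : ℝ) < N := by exact_mod_cast hN
  set q := p.toReal
  have hq0 : 0 < q := by linarith
  have h := Real.rpow_sum_le_const_mul_sum_rpow Finset.univ (fun j => ‖z j‖ ^ 2)
    (by linarith : 1 ≤ q / 2)
  have hterm : ∀ j, |‖z j‖ ^ 2| ^ (q / 2) = ‖z j‖ ^ q := fun j => by
    rw [abs_of_nonneg (by positivity), ← Real.rpow_natCast, ← Real.rpow_mul (norm_nonneg _)]
    congr 1
    push_cast
    ring
  simp only [hterm, Finset.card_univ, Fintype.card_fin] at h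
  simp only [abs_pow, abs_norm] at h
  rw [EuclideanSpace.norm_eq, lpNorm, if_neg hp]
  rw [← Real.rpow_le_rpow_iff (by positivity) (by positivity) hq0,
    Real.mul_rpow (by positivity) (by positivity), ← Real.rpow_mul (by positivity),
    one_div_mul_cancel hq0.ne', Real.rpow_one, Real.div_rpow (by positivity) (by positivity),
    ← Real.rpow_mul hN'.le, one_div_mul_cancel hq0.ne', Real.rpow_one, Real.sqrt_eq_rpow,
    Real.sqrt_eq_rpow, ← Real.rpow_mul (by positivity), ← Real.rpow_mul hN'.le,
    ← Real.rpow_sub_one hN'.ne', one_div_mul_eq_div]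
  exact h

theorem quarter_le_of_lpNorm_single_sub_le {p : ℝ≥0∞} (hp2 : 2 ≤ p) (hp : p ≠ ∞) {N n : ℕ}
    (hn : 1 ≤ n) (hnN : (n : ℝ) ≤ N / 4) (L : Submodule ℂ (Fin N → ℂ))
    (hL : Module.finrank ℂ L ≤ n) {δ : ℝ} (hδ : δ ≤ 1 / 4) (y : Fin N → Fin N → ℂ)
    (hy : ∀ j, y j ∈ L) (hdist : ∀ j, lpNorm p (Pi.single j 1 - y j) ≤ δ) :
    1 / 4 * ((N : ℝ) ^ (1 / p.toReal) / √n) ≤ δ := by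
  have hn' : (0 : ℝ) < n := by exact_mod_cast hn
  have hN' : (0 : ℝ) < N := by linarith
  have hN : 0 < N := by exact_mod_cast hN'
  have hq : 0 < p.toReal := ENNReal.toReal_pos (by positivity) hp
  have hsn : 0 < √(n : ℝ) := Real.sqrt_pos.2 hn'
  have hsN : 0 < √(N : ℝ) := Real.sqrt_pos.2 hN'
  set T : ℝ := (N : ℝ) ^ (1 / p.toReal) with hT
  have hT0 : 0 < T := by positivity
  let e := (WithLp.linearEquiv 2 ℂ (Fin N → ℂ)).symm
  have hdiag : ∀ j, 3 / 4 ≤ (y j j).re := by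
    intro j
    have hj : ‖1 - y j j‖ ≤ δ := by
      refine le_trans ?_ (hdist j)
      rw [lpNorm, if_neg hp]
      have h := Finset.single_le_sum (f := fun i => ‖(Pi.single j 1 - y j : Fin N → ℂ) i‖ ^ p.toReal)
        (fun i _ => by positivity) (Finset.mem_univ j)
      simp only [Pi.sub_apply, Pi.single_eq_same] at h
      have := Real.rpow_le_rpow (by positivity) h (by positivity : 0 ≤ 1 / p.toReal)
      rwa [← Real.rpow_mul (norm_nonneg _), mul_one_div_cancel hq.ne', Real.rpow_one] at this
    have := (Complex.re_le_norm _).trans hj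
    simp only [Complex.sub_re, Complex.one_re] at this
    linarith
  have htrace : N * (3 / 4) ≤ ‖∑ j, y j j‖ := by
    refine le_trans ?_ (Complex.re_le_norm _)
    rw [Complex.re_sum]
    have := Finset.card_nsmul_le_sum Finset.univ (fun j => (y j j).re) (3 / 4) fun j _ => hdiag j
    simpa using this
  have hnorm : ∀ j, ‖e (y j)‖ ≤ 1 + √N / T * δ := by
    intro j
    have h1 : e (y j) = e (Pi.single j 1) - e (Pi.single j 1 - y j) := by
      rw [map_sub, sub_sub_cancel]
    rw [h1]
    refine (norm_sub_le _ _).trans ?_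
    have h2 : ‖e (Pi.single j 1)‖ = 1 := by
      have : e (Pi.single j 1) = EuclideanSpace.single j (1 : ℂ) := rfl
      rw [this, PiLp.norm_single, norm_one]
    rw [h2]
    gcongr
    refine (norm_euclidean_le_mul_lpNorm hp2 hp hN _).trans ?_
    gcongr
    exact hdist j
  have hδ0 : 0 ≤ δ := (lpNorm_nonneg p _).trans (hdist ⟨0, hN⟩)
  have hHS : √(∑ j, ‖e (y j)‖ ^ 2) ≤ √N * (1 + √N / T * δ) := by
    rw [Real.sqrt_le_left (by positivity), mul_pow, Real.sq_sqrt hN'.le]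
    calc _ ≤ ∑ j : Fin N, (1 + √N / T * δ) ^ 2 := by
          gcongr with j
          exact hnorm j
      _ = _ := by simp
  have hmain := norm_sum_diag_le (L.map e.toLinearMap) (fun j => e (y j))
    fun j => Submodule.mem_map_of_mem (hy j)
  have hrank : Module.finrank ℂ (L.map e.toLinearMap) ≤ n :=
    (Submodule.finrank_map_le _ _).trans hL
  have hbound : N * (3 / 4) ≤ √n * (√N * (1 + √N / T * δ)) := by
    refine htrace.trans (hmain.trans ?_)
    gcongr
  have hnN' : 2 * √n ≤ √N := by
    rw [← Real.sqrt_sq (by norm_num : (0 : ℝ) ≤ 2), ← Real.sqrt_mul (by norm_num)]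
    exact Real.sqrt_le_sqrt (by linarith)
  have hcancel : √N * (3 / 4) ≤ √n * (1 + √N / T * δ) := by
    refine le_of_mul_le_mul_left ?_ hsN
    calc √N * (√N * (3 / 4)) = N * (3 / 4) := by
          rw [← mul_assoc, Real.mul_self_sqrt hN'.le]
      _ ≤ _ := hbound
      _ = _ := by ring
  have hfin : √N * (1 / 4) ≤ √N * (√n / T * δ) := by
    calc √N * (1 / 4) ≤ √n * (1 + √N / T * δ) - √n := by linarith
      _ = _ := by ring
  have := le_of_mul_le_mul_left hfin hsN
  calc 1 / 4 * (T / √n) ≤ (√n / T * δ) * (T / √n) := by gcongr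
    _ = δ := by field_simp

theorem sum_rpow_norm_le_one {p : ℝ≥0∞} (hp0 : p ≠ 0) (hp : p ≠ ∞) {q : ℝ} (hpq : p.toReal ≤ q)
    {N : ℕ} {x : Fin N → ℂ} (hx : lpNorm p x ≤ 1) : ∑ j, ‖x j‖ ^ q ≤ 1 := by
  have hp' : 0 < p.toReal := ENNReal.toReal_pos hp0 hp
  have hsum : ∑ j, ‖x j‖ ^ p.toReal ≤ 1 := by
    rw [lpNorm, if_neg hp] at hx
    by_contra! h
    exact hx.not_gt (Real.one_lt_rpow h (by positivity))
  refine le_trans (Finset.sum_le_sum fun j _ => ?_) hsum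
  have hj : ‖x j‖ ^ p.toReal ≤ 1 :=
    (Finset.single_le_sum (f := fun j => ‖x j‖ ^ p.toReal) (fun i _ => by positivity)
      (Finset.mem_univ j)).trans hsum
  have hj1 : ‖x j‖ ≤ 1 := by
    by_contra! h
    exact hj.not_gt (Real.one_lt_rpow h hp')
  rcases (norm_nonneg (x j)).eq_or_lt with h0 | h0
  · rw [← h0, Real.zero_rpow hp'.ne', Real.zero_rpow (by linarith)]
  · exact Real.rpow_le_rpow_of_exponent_ge h0 hj1 hpq

theorem lpNorm_zero {p : ℝ≥0∞} (hp0 : p ≠ 0) (hp : p ≠ ∞) {N : ℕ} :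
    lpNorm p (0 : Fin N → ℂ) = 0 := by
  have := (ENNReal.toReal_pos hp0 hp).ne'
  simp [lpNorm, hp, this]

theorem lpNorm_single_one {p : ℝ≥0∞} (hp0 : p ≠ 0) (hp : p ≠ ∞) {N : ℕ} (j : Fin N) :
    lpNorm p (Pi.single j 1 : Fin N → ℂ) = 1 := by
  have hq := (ENNReal.toReal_pos hp0 hp).ne'
  rw [lpNorm, if_neg hp, Finset.sum_eq_single j]
  · simp
  · intro i _ hij
    simp [Pi.single_eq_of_ne hij, hq]
  · simp

theorem sInf_lpNorm_sub_le_one {p1 p2 : ℝ≥0∞} (hp1 : p1 ≠ 0) (hp12 : p1 ≤ p2) (hp2 : p2 ≠ ∞)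
    {N : ℕ} (L : Submodule ℂ (Fin N → ℂ)) {x : Fin N → ℂ} (hx : lpNorm p1 x ≤ 1) :
    sInf {s : ℝ | ∃ y ∈ L, s = lpNorm p2 (x - y)} ≤ 1 := by
  refine (csInf_le (bddBelow_lpNorm_sub p2 L x) ⟨0, L.zero_mem, rfl⟩).trans ?_
  rw [sub_zero, lpNorm, if_neg hp2]
  exact Real.rpow_le_one (by positivity)
    (sum_rpow_norm_le_one hp1 (ne_top_of_le_ne_top hp2 hp12) (ENNReal.toReal_mono hp2 hp12) hx)
    (by positivity)

theorem kolmogorovLp_le {p1 p2 : ℝ≥0∞} (hp1 : p1 ≠ 0) (hp1' : p1 ≠ ∞) {N n : ℕ}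
    (L : Submodule ℂ (Fin N → ℂ)) (hL : Module.finrank ℂ L < n) {B : ℝ}
    (hB : ∀ x : Fin N → ℂ, lpNorm p1 x ≤ 1 →
      sInf {s : ℝ | ∃ y ∈ L, s = lpNorm p2 (x - y)} ≤ B) :
    kolmogorovLp p1 p2 N n ≤ B := by
  have hle : kolmogorovLp p1 p2 N n ≤ sSup {t : ℝ | ∃ x : Fin N → ℂ, lpNorm p1 x ≤ 1 ∧
      t = sInf {s : ℝ | ∃ y ∈ L, s = lpNorm p2 (x - y)}} := csInf_le ⟨0, ?_⟩ ⟨L, hL, rfl⟩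
  · refine hle.trans (csSup_le ⟨_, 0, by simp [lpNorm_zero hp1 hp1'], rfl⟩ ?_)
    rintro _ ⟨x, hx, rfl⟩
    exact hB x hx
  · rintro _ ⟨L', _, rfl⟩
    refine Real.sSup_nonneg ?_
    rintro _ ⟨x, _, rfl⟩
    refine Real.sInf_nonneg ?_
    rintro _ ⟨y, _, rfl⟩
    exact lpNorm_nonneg p2 _

theorem le_kolmogorovLp {p1 p2 : ℝ≥0∞} (hp1 : p1 ≠ 0) (hp12 : p1 ≤ p2) (hp2 : 2 ≤ p2)
    (hp2' : p2 ≠ ∞) {N n : ℕ} (hn : 1 ≤ n) (hnN : (n : ℝ) ≤ N / 4) :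
    1 / 4 * min 1 ((N : ℝ) ^ (1 / p2.toReal) / √n) ≤ kolmogorovLp p1 p2 N n := by
  refine le_csInf ⟨_, ⊥, by rwa [finrank_bot], rfl⟩ ?_
  rintro _ ⟨L, hL, rfl⟩
  by_contra! hlt
  obtain ⟨δ, hδ, hδ'⟩ := exists_between hlt
  have hy : ∀ j : Fin N, ∃ y ∈ L, lpNorm p2 (Pi.single j 1 - y) ≤ δ := by
    intro j
    have hj : sInf {s : ℝ | ∃ y ∈ L, s = lpNorm p2 (Pi.single j 1 - y)} < δ := by
      refine lt_of_le_of_lt (le_csSup (s := {t : ℝ | ∃ x : Fin N → ℂ, lpNorm p1 x ≤ 1 ∧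
        t = sInf {s : ℝ | ∃ y ∈ L, s = lpNorm p2 (x - y)}}) ⟨1, ?_⟩ ⟨Pi.single j 1, ?_, rfl⟩) hδ
      · rintro _ ⟨x, hx, rfl⟩
        exact sInf_lpNorm_sub_le_one hp1 hp12 hp2' L hx
      · exact (lpNorm_single_one hp1 (ne_top_of_le_ne_top hp2' hp12) j).le
    obtain ⟨_, ⟨y, hyL, rfl⟩, hlt'⟩ := exists_lt_of_csInf_lt
      (show {s : ℝ | ∃ y ∈ L, s = lpNorm p2 (Pi.single j 1 - y)}.Nonempty from
        ⟨_, 0, L.zero_mem, rfl⟩) hj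
    exact ⟨y, hyL, hlt'.le⟩
  choose y hyL hyδ using hy
  have h1 := min_le_left 1 ((N : ℝ) ^ (1 / p2.toReal) / √n)
  have h2 := min_le_right 1 ((N : ℝ) ^ (1 / p2.toReal) / √n)
  have := quarter_le_of_lpNorm_single_sub_le hp2 hp2' hn hnN L hL.le (by linarith) y hyL hyδ
  linarith

theorem kolmogorovLp_le_one {p1 p2 : ℝ≥0∞} (hp1 : p1 ≠ 0) (hp12 : p1 ≤ p2) (hp2 : p2 ≠ ∞)
    {N n : ℕ} (hn : 1 ≤ n) : kolmogorovLp p1 p2 N n ≤ 1 :=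
  kolmogorovLp_le hp1 (ne_top_of_le_ne_top hp2 hp12) ⊥ (by rwa [finrank_bot])
    fun _ hx => sInf_lpNorm_sub_le_one hp1 hp12 hp2 ⊥ hx

theorem kolmogorovLp_le_mul {p1 p2 : ℝ≥0∞} (hp1 : p1 ≠ 0) (hp1' : p1 ≤ 2) (hp2 : 1 ≤ p2)
    (hp2' : p2 ≠ ∞) {N n : ℕ} (hn : 2 ≤ n) (hN : 0 < N) :
    kolmogorovLp p1 p2 N n ≤
      16 * momentConst p2.toReal ^ (1 / p2.toReal) * ((N : ℝ) ^ (1 / p2.toReal) / √n) := by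
  have hp1t : p1 ≠ ∞ := ne_top_of_le_ne_top (by simp) hp1'
  have hM := momentConst_pos p2.toReal
  obtain ⟨L, hL, hLx⟩ := exists_submodule_sInf_lpNorm_sub_le hp2 hp2' hN (m := n - 1) (by omega)
  refine kolmogorovLp_le hp1 hp1t L (by omega) fun x hx => ?_
  have hx2 : ∑ j, ‖x j‖ ^ 2 ≤ 1 := by
    have h2 : p1.toReal ≤ 2 := by simpa using ENNReal.toReal_mono (by simp) hp1'
    exact_mod_cast sum_rpow_norm_le_one hp1 hp1t h2 hx
  refine (hLx x hx2).trans ?_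
  have hn' : (0 : ℝ) < n := by exact_mod_cast (by omega : 0 < n)
  have hsn : 0 < √(n : ℝ) := Real.sqrt_pos.2 hn'
  have hcast : ((n - 1 : ℕ) : ℝ) = n - 1 := by
    rw [Nat.cast_sub (by omega), Nat.cast_one]
  have hn2 : (2 : ℝ) ≤ n := by exact_mod_cast hn
  have hhalf : √n / 2 ≤ √((n - 1 : ℕ) : ℝ) := by
    refine Real.le_sqrt_of_sq_le ?_
    rw [div_pow, Real.sq_sqrt hn'.le, hcast]
    linarith
  calc _ ≤ 8 * (momentConst p2.toReal ^ (1 / p2.toReal) * (N : ℝ) ^ (1 / p2.toReal)) / (√n / 2) := by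
        gcongr
    _ = _ := by field_simp; norm_num

/-- Let `1 ≤ p1 < 2 < p2 < ∞`. There is a constant `c > 0`, depending only
on `p1, p2`, such that for all `N` and all `n` with `n ≤ N/4`,
`c⁻¹ * min{1, N^{1/p2} n^{-1/2}} ≤ d_n(id : ℓ_{p1}^N → ℓ_{p2}^N) ≤ c * min{1, N^{1/p2} n^{-1/2}}`. -/
theorem kolmogorov_id_lp_small_large (p1 p2 : ℝ≥0∞) (hp1 : 1 ≤ p1) (hp12 : p1 < 2)
    (hp2 : 2 < p2) (hp2' : p2 ≠ ∞) :
    ∃ c : ℝ, 0 < c ∧ ∀ N n : ℕ, 1 ≤ n → (n : ℝ) ≤ (N : ℝ) / 4 →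
      c⁻¹ * min 1 ((N : ℝ) ^ (1 / p2.toReal) * (n : ℝ) ^ (-(1 : ℝ) / 2)) ≤
        kolmogorovLp p1 p2 N n ∧
      kolmogorovLp p1 p2 N n ≤
        c * min 1 ((N : ℝ) ^ (1 / p2.toReal) * (n : ℝ) ^ (-(1 : ℝ) / 2)) := by
  have hp1' : p1 ≠ 0 := (zero_lt_one.trans_le hp1).ne'
  have hle : p1 ≤ p2 := (hp12.trans hp2).le
  have hM := momentConst_pos p2.toReal
  set M : ℝ := momentConst p2.toReal ^ (1 / p2.toReal)
  refine ⟨max 4 (16 * M), by positivity, fun N n hn hnN => ?_⟩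
  have hn' : (1 : ℝ) ≤ n := by exact_mod_cast hn
  have hN' : (1 : ℝ) ≤ N := by linarith
  have hsqrt : (N : ℝ) ^ (1 / p2.toReal) * (n : ℝ) ^ (-(1 : ℝ) / 2) =
      (N : ℝ) ^ (1 / p2.toReal) / √n := by
    rw [neg_div, Real.rpow_neg (by positivity), Real.sqrt_eq_rpow, ← div_eq_mul_inv]
  rw [hsqrt]
  constructor
  · refine le_trans ?_ (le_kolmogorovLp hp1' hle hp2.le hp2' hn hnN)
    gcongr
    rw [one_div]
    exact inv_anti₀ (by norm_num) (le_max_left _ _)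
  · have h1 := kolmogorovLp_le_one (N := N) hp1' hle hp2' hn
    rw [mul_min_of_nonneg _ _ (by positivity)]
    refine le_min (by linarith [le_max_left 4 (16 * M)]) ?_
    have hT : 1 ≤ (N : ℝ) ^ (1 / p2.toReal) := Real.one_le_rpow hN' (by positivity)
    rcases hn.eq_or_lt with rfl | hn2
    · rw [Nat.cast_one, Real.sqrt_one, div_one]
      nlinarith [le_max_left 4 (16 * M)]
    · refine (kolmogorovLp_le_mul hp1' hp12.le (hp1.trans hle) hp2' hn2
        (by exact_mod_cast hN')).trans ?_
      gcongr
      exact le_max_right _ _
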